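/- Let a, b, c be positive integers with gcd(a,b) = gcd(b,c) = gcd(c,a) = 1. Set α = (a+b+c)/2, β = 2abc, M = ⌊((2αβ−1)² − 4α²)/(4β) + α⌋ + 1 and γ_k = ⌊√(β(k+α) + α²) − α⌋. If k ≥ M, then every nonnegative integer t with N(a,b,c;t) = k satisfies t = γ_k. -/

import Mathlib

/-- `numSol a b c n` is the number of triples `(x, y, z)` of nonnegative integers
satisfying `a*x + b*y + c*z = n`. -/
noncomputable def numSol (a b c n : ℕ) : ℕ :=
  {p : ℕ × ℕ × ℕ | a * p.1 + b * p.2.1 + c * p.2.2 = n}.ncard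

/-- The centred partial sums of a sequence that runs through all residues modulo `a` in every
block of length `a` are bounded. -/
lemma abs_sum_centered_le (a : ℕ) (ha : 0 < a) (m : ℕ) :
    ∀ f : ℕ → ℕ, (∀ j, f j < a) → (∀ i j, f i = f j → i ≡ j [MOD a]) →
      |∑ j ∈ Finset.range m, ((a : ℤ) - 1 - 2 * f j)| ≤ ((a : ℤ) - 1) ^ 2 := by
  induction m using Nat.strong_induction_on with
  | _ m ih =>
    intro f hf hinj
    rcases lt_or_ge m a with hma | hma
    · calc |∑ j ∈ Finset.range m, ((a : ℤ) - 1 - 2 * f j)|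
          ≤ ∑ j ∈ Finset.range m, |(a : ℤ) - 1 - 2 * f j| := Finset.abs_sum_le_sum_abs _ _
        _ ≤ ∑ _j ∈ Finset.range m, ((a : ℤ) - 1) := by
            refine Finset.sum_le_sum fun j _ => ?_
            have := hf j
            rw [abs_le]
            constructor <;> omega
        _ = m * ((a : ℤ) - 1) := by
            rw [Finset.sum_const, Finset.card_range, nsmul_eq_mul]
        _ ≤ ((a : ℤ) - 1) ^ 2 := by
            have h1 : (m : ℤ) ≤ a - 1 := by omega
            have h2 : (0 : ℤ) ≤ a - 1 := by omega
            nlinarith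
    · obtain ⟨s, rfl⟩ := Nat.exists_eq_add_of_le hma
      have himg : (Finset.range a).image f = Finset.range a := by
        apply Finset.eq_of_subset_of_card_le
        · intro x hx
          obtain ⟨j, -, rfl⟩ := Finset.mem_image.1 hx
          exact Finset.mem_range.2 (hf j)
        · rw [Finset.card_image_of_injOn]
          intro i hi j hj hij
          simp only [Finset.coe_range, Set.mem_Iio] at hi hj
          exact Nat.ModEq.eq_of_lt_of_lt (hinj i j hij) hi hj
      have hblock : ∑ j ∈ Finset.range a, f j = ∑ j ∈ Finset.range a, j := by
        conv_rhs => rw [← himg]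
        rw [Finset.sum_image]
        intro i hi j hj hij
        simp only [Finset.coe_range, Set.mem_Iio] at hi hj
        exact Nat.ModEq.eq_of_lt_of_lt (hinj i j hij) hi hj
      have hzero : ∑ j ∈ Finset.range a, ((a : ℤ) - 1 - 2 * f j) = 0 := by
        have h := Finset.sum_range_id_mul_two a
        rw [← hblock] at h
        obtain ⟨d, rfl⟩ : ∃ d, a = d + 1 := ⟨a - 1, by omega⟩
        have h' : ((∑ j ∈ Finset.range (d + 1), (f j : ℤ)) * 2) = (d + 1) * d := by
          exact_mod_cast h
        rw [Finset.sum_sub_distrib, ← Finset.mul_sum]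
        simp only [Finset.sum_const, Finset.card_range, nsmul_eq_mul]
        push_cast
        linarith
      rw [Finset.sum_range_add, hzero, zero_add]
      refine ih s (by omega) (fun j => f (a + j)) (fun j => hf _) fun i j hij => ?_
      exact Nat.ModEq.add_left_cancel' a (hinj _ _ hij)

/-- Popoviciu's formula for the number of solutions of `a * x + b * y = n`. -/
lemma card_two_coin (a b n u v : ℕ) (ha : 0 < a) (hb : 0 < b) (hab : Nat.Coprime a b)
    (hu : u < a) (hv : v < b) (hun : b * u ≡ n [MOD a]) (hvn : a * v ≡ n [MOD b]) :
    (a : ℤ) * b * {p : ℕ × ℕ | a * p.1 + b * p.2 = n}.ncard = n + a * b - b * u - a * v := by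
  have hda : (a : ℤ) ∣ n + a * b - b * u - a * v := by
    have h := (Nat.modEq_iff_dvd.1 hun)
    push_cast at h
    have e : (n : ℤ) + a * b - b * u - a * v = (n - b * u) + a * (b - v) := by ring
    rw [e]
    exact dvd_add h (dvd_mul_right _ _)
  have hdb : (b : ℤ) ∣ n + a * b - b * u - a * v := by
    have h := (Nat.modEq_iff_dvd.1 hvn)
    push_cast at h
    have e : (n : ℤ) + a * b - b * u - a * v = (n - a * v) + b * (a - u) := by ring
    rw [e]
    exact dvd_add h (dvd_mul_right _ _)
  obtain ⟨q, hq⟩ := (Nat.isCoprime_iff_coprime.2 hab).mul_dvd hda hdb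
  have hab0 : (0 : ℤ) < a * b := by positivity
  have hq0 : 0 ≤ q := by
    by_contra! hneg
    have h1 : (a : ℤ) * b * q ≤ -(a * b) := by nlinarith
    have h2 : (b : ℤ) * u ≤ b * (a - 1) := by
      have : (u : ℤ) ≤ a - 1 := by omega
      gcongr
    have h3 : (a : ℤ) * v ≤ a * (b - 1) := by
      have : (v : ℤ) ≤ b - 1 := by omega
      gcongr
    nlinarith
  lift q to ℕ using hq0
  rw [hq]
  congr 2
  have himg : {p : ℕ × ℕ | a * p.1 + b * p.2 = n} =
      (fun j : ℕ => (v + b * (q - 1 - j), u + a * j)) '' (Finset.range q : Set ℕ) := by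
    ext ⟨x, y⟩
    simp only [Set.mem_ofPred_eq, Set.mem_image, Finset.coe_range, Set.mem_Iio, Prod.mk.injEq]
    constructor
    · intro h
      have hx : x ≡ v [MOD b] := by
        apply Nat.ModEq.cancel_left_of_coprime (c := a) (by simpa using hab.symm)
        refine Nat.ModEq.trans ?_ hvn.symm
        rw [← h]
        simp [Nat.ModEq]
      have hy : y ≡ u [MOD a] := by
        apply Nat.ModEq.cancel_left_of_coprime (c := b) (by simpa using hab)
        refine Nat.ModEq.trans ?_ hun.symm
        rw [← h]
        simp [Nat.ModEq]
      have hvx : v ≤ x := by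
        rw [← Nat.mod_eq_of_lt hv, ← hx]; exact Nat.mod_le _ _
      have huy : u ≤ y := by
        rw [← Nat.mod_eq_of_lt hu, ← hy]; exact Nat.mod_le _ _
      obtain ⟨i, hi⟩ := (Nat.modEq_iff_dvd' hvx).1 hx.symm
      obtain ⟨j, hj⟩ := (Nat.modEq_iff_dvd' huy).1 hy.symm
      have hx' : x = v + b * i := by omega
      have hy' : y = u + a * j := by omega
      subst hx' hy'
      have hij : (i : ℤ) + j + 1 = q := by
        apply mul_left_cancel₀ hab0.ne'
        rw [← hq, ← h]
        push_cast
        ring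
      refine ⟨j, by omega, ?_, rfl⟩
      congr 2
      omega
    · rintro ⟨j, hj, rfl, rfl⟩
      obtain ⟨i, rfl⟩ : ∃ i, q = i + j + 1 := ⟨q - 1 - j, by omega⟩
      have e : i + j + 1 - 1 - j = i := by omega
      rw [e]
      zify
      push_cast at hq
      linarith
  rw [himg, Set.ncard_image_of_injective, Set.ncard_coe_finset, Finset.card_range]
  intro i j hij
  simp only [Prod.mk.injEq, add_right_inj] at hij
  exact Nat.eq_of_mul_eq_mul_left ha hij.2

lemma exists_mul_modEq (a b : ℕ) (ha : 0 < a) (hab : Nat.Coprime a b) (n : ℕ) :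
    ∃ u, u < a ∧ b * u ≡ n [MOD a] := by
  obtain ⟨m, hm⟩ := Nat.exists_mul_mod_eq_of_coprime n hab.symm ha.ne'
  refine ⟨m % a, Nat.mod_lt _ ha, ?_⟩
  exact ((Nat.mod_modEq m a).mul_left b).trans hm.2

/-- Slicing the solutions of a three-variable equation by the last variable. -/
lemma numSol_eq_sum (a b c n r : ℕ) (ha : 0 < a) (hb : 0 < b) (hr : r < c) :
    numSol a b c (c * n + r) =
      ∑ j ∈ Finset.range (n + 1), {p : ℕ × ℕ | a * p.1 + b * p.2 = r + c * j}.ncard := by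
  have hfin (s : ℕ) : {p : ℕ × ℕ | a * p.1 + b * p.2 = s}.Finite := by
    refine ((Set.finite_Iic s).prod (Set.finite_Iic s)).subset ?_
    rintro ⟨x, y⟩ h
    simp only [Set.mem_ofPred_eq] at h
    simp only [Set.mem_prod, Set.mem_Iic]
    constructor <;> nlinarith
  have hset : {p : ℕ × ℕ × ℕ | a * p.1 + b * p.2.1 + c * p.2.2 = c * n + r} =
      (((Finset.range (n + 1)).sigma fun j => (hfin (r + c * j)).toFinset).image
        fun q => (q.2.1, q.2.2, n - q.1) : Finset (ℕ × ℕ × ℕ)) := by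
    ext ⟨x, y, z⟩
    simp only [Set.mem_ofPred_eq, Finset.coe_image, Set.mem_image, Finset.mem_coe,
      Finset.mem_sigma, Finset.mem_range, Set.Finite.mem_toFinset, Prod.mk.injEq]
    constructor
    · intro h
      have hz : z ≤ n := by
        by_contra! hlt
        have : c * (n + 1) ≤ c * z := Nat.mul_le_mul_left c hlt
        rw [mul_add] at this
        omega
      obtain ⟨j, rfl⟩ := Nat.exists_eq_add_of_le hz
      refine ⟨⟨j, x, y⟩, ⟨by dsimp only; omega, ?_⟩, rfl, rfl, by simp⟩
      simp only
      rw [mul_add] at h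
      omega
    · rintro ⟨⟨j, x', y'⟩, ⟨hj, h⟩, rfl, rfl, rfl⟩
      simp only at hj h ⊢
      obtain ⟨i, rfl⟩ := Nat.exists_eq_add_of_le (Nat.lt_succ_iff.1 hj)
      rw [Nat.add_sub_cancel_left, h]
      ring
  rw [numSol, hset, Set.ncard_coe_finset, Finset.card_image_of_injOn, Finset.card_sigma]
  · exact Finset.sum_congr rfl fun j _ => (Set.ncard_eq_toFinset_card _ _).symm
  · rintro ⟨j, x, y⟩ h ⟨j', x', y'⟩ h' heq
    simp only [Finset.mem_coe, Finset.mem_sigma, Finset.mem_range] at h h'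
    simp only [Prod.mk.injEq] at heq
    obtain ⟨rfl, rfl, hj⟩ := heq
    obtain rfl : j = j' := by omega
    rfl

lemma bounds_of_abs_le_sub_one_sq {x S : ℤ} (hx : 1 ≤ x) (hS : |S| ≤ (x - 1) ^ 2) :
    -x ^ 2 ≤ S ∧ S + 1 ≤ x ^ 2 := by
  rw [abs_le] at hS
  constructor <;> nlinarith

lemma abs_deviation_le {a b c r Su Sv : ℤ} (ha : 1 ≤ a) (hb : 1 ≤ b) (hc : 1 ≤ c)
    (hr : 0 ≤ r) (hrc : r ≤ c) (hSu : |Su| ≤ (a - 1) ^ 2) (hSv : |Sv| ≤ (b - 1) ^ 2) :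
    |(c - r) * r + (c - r) * (a + b) + c * (b * Su) + c * (a * Sv)| ≤
      a * b * c * (a + b + c) := by
  obtain ⟨hu, hu'⟩ := bounds_of_abs_le_sub_one_sq ha hSu
  obtain ⟨hv, hv'⟩ := bounds_of_abs_le_sub_one_sq hb hSv
  clear hSu hSv
  have hcr : 0 ≤ c - r := by linarith
  have hrr : (c - r) * r ≤ (a * b) * (c * c) := by
    have h1 : (c - r) * r ≤ c * c := by gcongr; linarith
    have h2 : 1 ≤ a * b := one_le_mul_of_one_le_of_one_le ha hb
    have h3 : 1 * (c * c) ≤ (a * b) * (c * c) := by gcongr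
    linarith
  have hrab : (c - r) * (a + b) ≤ c * (a + b) := by gcongr; linarith
  have hU : c * (b * (Su + 1)) ≤ c * (b * a ^ 2) := by gcongr
  have hV : c * (a * (Sv + 1)) ≤ c * (a * b ^ 2) := by gcongr
  have hU' : c * (b * (-a ^ 2)) ≤ c * (b * Su) := by gcongr
  have hV' : c * (a * (-b ^ 2)) ≤ c * (a * Sv) := by gcongr
  have hpos : 0 ≤ (c - r) * r + (c - r) * (a + b) := by positivity
  have habc : 0 ≤ a * b * c * c := by positivity
  rw [abs_le]
  constructor <;> linarith

/-- The deviation of the denumerant from its polynomial part. -/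
lemma abs_numSol_sub_le (a b c t : ℕ) (ha : 0 < a) (hb : 0 < b) (hc : 0 < c)
    (hab : Nat.Coprime a b) (hbc : Nat.Coprime b c) (hca : Nat.Coprime c a) :
    |2 * (a : ℤ) * b * c * numSol a b c t - ((t : ℤ) ^ 2 + (a + b + c) * t)| ≤
      (a : ℤ) * b * c * (a + b + c) := by
  obtain ⟨n, r, hr, rfl⟩ : ∃ n r, r < c ∧ t = c * n + r :=
    ⟨t / c, t % c, Nat.mod_lt _ hc, (Nat.div_add_mod t c).symm⟩
  choose u hu hun using fun j : ℕ => exists_mul_modEq a b ha hab (r + c * j)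
  choose v hv hvn using fun j : ℕ => exists_mul_modEq b a hb hab.symm (r + c * j)
  have hSu := abs_sum_centered_le a ha (n + 1) u hu fun i j hij => by
    have h := (hun i).symm.trans (hij ▸ hun j)
    exact Nat.ModEq.cancel_left_of_coprime (by simpa using hca.symm)
      (Nat.ModEq.add_left_cancel' r h)
  have hSv := abs_sum_centered_le b hb (n + 1) v hv fun i j hij => by
    have h := (hvn i).symm.trans (hij ▸ hvn j)
    exact Nat.ModEq.cancel_left_of_coprime (by simpa using hbc)
      (Nat.ModEq.add_left_cancel' r h)
  have hgauss : 2 * ∑ j ∈ Finset.range (n + 1), (j : ℤ) = (n + 1) * n := by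
    have h := Finset.sum_range_id_mul_two (n + 1)
    zify at h
    push_cast [Nat.add_sub_cancel] at h
    linarith
  have hN : 2 * (a : ℤ) * b * numSol a b c (c * n + r) =
      (n + 1) * (2 * r + c * n + a + b)
        + b * ∑ j ∈ Finset.range (n + 1), ((a : ℤ) - 1 - 2 * u j)
        + a * ∑ j ∈ Finset.range (n + 1), ((b : ℤ) - 1 - 2 * v j) := by
    have hterm : ∑ j ∈ Finset.range (n + 1),
        2 * ((a : ℤ) * b * {p : ℕ × ℕ | a * p.1 + b * p.2 = r + c * j}.ncard) =
        ∑ j ∈ Finset.range (n + 1), ((2 * r + a + b) + c * (2 * (j : ℤ))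
          + b * ((a : ℤ) - 1 - 2 * u j) + a * ((b : ℤ) - 1 - 2 * v j)) := by
      refine Finset.sum_congr rfl fun j _ => ?_
      rw [card_two_coin a b _ (u j) (v j) ha hb hab (hu j) (hv j) (hun j) (hvn j)]
      push_cast
      ring
    rw [← Finset.mul_sum, ← Finset.mul_sum, Finset.sum_add_distrib, Finset.sum_add_distrib,
      Finset.sum_add_distrib, ← Finset.mul_sum, ← Finset.mul_sum, ← Finset.mul_sum,
      ← Finset.mul_sum, hgauss] at hterm
    rw [numSol_eq_sum a b c n r ha hb hr]
    push_cast
    simp only [Finset.sum_const, Finset.card_range, nsmul_eq_mul] at hterm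
    push_cast at hterm
    linear_combination hterm
  generalize ∑ j ∈ Finset.range (n + 1), ((a : ℤ) - 1 - 2 * u j) = Su at hSu hN
  generalize ∑ j ∈ Finset.range (n + 1), ((b : ℤ) - 1 - 2 * v j) = Sv at hSv hN
  have hdev : 2 * (a : ℤ) * b * c * numSol a b c (c * n + r)
      - (((c * n + r : ℕ) : ℤ) ^ 2 + (a + b + c) * ((c * n + r : ℕ) : ℤ)) =
      (c - r) * r + (c - r) * (a + b) + c * (b * Su) + c * (a * Sv) := by
    push_cast
    linear_combination (c : ℤ) * hN
  rw [hdev]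
  exact abs_deviation_le (by exact_mod_cast ha) (by exact_mod_cast hb) (by exact_mod_cast hc)
    (by positivity) (by exact_mod_cast hr.le) hSu hSv

theorem stmt_6 (a b c : ℕ)
    (ha : 0 < a) (hb : 0 < b) (hc : 0 < c)
    (hab : Nat.gcd a b = 1) (hbc : Nat.gcd b c = 1) (hca : Nat.gcd c a = 1)
    (α β : ℝ) (hα : α = ((a : ℝ) + b + c) / 2) (hβ : β = 2 * a * b * c)
    (M : ℤ) (hM : M = ⌊((2 * α * β - 1) ^ 2 - 4 * α ^ 2) / (4 * β) + α⌋ + 1)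
    (k : ℕ)
    (γ : ℤ) (hγ : γ = ⌊Real.sqrt (β * ((k : ℝ) + α) + α ^ 2) - α⌋)
    (hk : M ≤ (k : ℤ)) :
    ∀ t : ℕ, numSol a b c t = k → (t : ℤ) = γ := by
  intro t ht
  have hdev := abs_numSol_sub_le a b c t ha hb hc hab hbc hca
  rw [ht] at hdev
  have hdevR : |2 * (a : ℝ) * b * c * k - ((t : ℝ) ^ 2 + (a + b + c) * t)| ≤
      (a : ℝ) * b * c * (a + b + c) := by exact_mod_cast hdev
  have hsum : (a : ℝ) + b + c = 2 * α := by rw [hα]; ring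
  have hprod : (a : ℝ) * b * c * (2 * α) = β * α := by rw [hβ]; ring
  rw [← hβ, hsum, hprod, abs_le] at hdevR
  obtain ⟨hlo, hhi⟩ := hdevR
  have hα0 : 0 < α := by rw [hα]; positivity
  have hβ0 : 0 < β := by rw [hβ]; positivity
  have ht0 : (0 : ℝ) ≤ t := by positivity
  have hkM : ((2 * α * β - 1) ^ 2 - 4 * α ^ 2) / (4 * β) + α < k := by
    have h := Int.lt_floor_add_one (((2 * α * β - 1) ^ 2 - 4 * α ^ 2) / (4 * β) + α)
    have h' : ((M : ℤ) : ℝ) ≤ k := by exact_mod_cast hk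
    rw [hM] at h'
    push_cast at h'
    linarith
  have hkM' : (2 * α * β - 1) ^ 2 - 4 * α ^ 2 < (k - α) * (4 * β) := by
    rw [← div_lt_iff₀ (by positivity)]
    linarith
  have htlarge : 2 * α * β - 1 < 2 * (t + α) := by
    apply lt_of_pow_lt_pow_left₀ 2 (by positivity)
    nlinarith
  rw [hγ, eq_comm, Int.floor_eq_iff]
  push_cast
  constructor
  · rw [le_sub_iff_add_le]
    apply Real.le_sqrt_of_sq_le
    nlinarith
  · rw [sub_lt_iff_lt_add, Real.sqrt_lt' (by positivity)]
    nlinarith
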